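/- Let K be a 3×3 complex matrix with simple spectrum and assume the SoV covectors ⟨h| and vectors |k⟩ form bases (generic parameters). Let k ∈ {0,2}^N, and let h ∈ {0,1,2}^N be such that either there exist a ≠ b in {1,…,N} with h_a ≠ k_a and h_b ≠ k_b, or there exists a with h_a = 1 and k_a = 0. Then for every c ∈ {1,…,N}: ⟨h| T₁^{(K)}( ξ_c − (δ_{h_c,0} + δ_{h_c,1})·η ) |k⟩ = 0. -/

import Mathlib

open scoped BigOperators

namespace SoV

noncomputable section

/-- Quantum states of the gl₃ chain of length `N`: labels of the natural tensor basis
of `H = (ℂ³)^{⊗N}`. -/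
abbrev St (N : ℕ) := Fin N → Fin 3
/-- The Hilbert space `H` (and its dual), realized as functions on basis labels. -/
abbrev Hsp (N : ℕ) := St N → ℂ
/-- Operators on `H`. -/
abbrev Op (N : ℕ) := Matrix (St N) (St N) ℂ

variable {N : ℕ}

/-- ξᵢ − ξⱼ ∉ {0, η, −η} for i ≠ j. -/
def InhomCond (η : ℂ) (ξ : Fin N → ℂ) : Prop :=
  ∀ i j : Fin N, i ≠ j → ξ i - ξ j ≠ 0 ∧ ξ i - ξ j ≠ η ∧ ξ i - ξ j ≠ -η

/-- Vandermonde product `V(x₁,…,x_M) = ∏_{i<j} (x_j − x_i)`. -/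
def Vdm {M : ℕ} (x : Fin M → ℂ) : ℂ :=
  ∏ j : Fin M, ∏ i ∈ Finset.univ.filter (fun i => i < j), (x j - x i)

/-- `d(λ) = ∏_a (λ − ξ_a)`. -/
def dfun (ξ : Fin N → ℂ) (lam : ℂ) : ℂ := ∏ a, (lam - ξ a)

/-- The quantum determinant at identity twist:
`q-det M^{(I)}(λ) = ∏_b (λ−ξ_b+η)(λ−ξ_b−η)(λ−ξ_b−2η)`. -/
def qdetI (η : ℂ) (ξ : Fin N → ℂ) (lam : ℂ) : ℂ :=
  ∏ b, ((lam - ξ b + η) * (lam - ξ b - η) * (lam - ξ b - 2 * η))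

/-- The rational gl₃ R-matrix `R_{a,n}(λ − ξ_n) = (λ−ξ_n)·Id + η·P` acting on the
auxiliary space (first factor) and the `n`-th site of the chain. -/
def Raux (η : ℂ) (ξ : Fin N → ℂ) (lam : ℂ) (n : Fin N) :
    Matrix (Fin 3 × St N) (Fin 3 × St N) ℂ := Matrix.of fun p q =>
  (lam - ξ n) * (if p = q then 1 else 0) +
    η * (if p.1 = q.2 n ∧ p.2 = Function.update q.2 n q.1 then 1 else 0)

/-- The twist matrix `K` acting on the auxiliary space. -/
def Kaux (K : Matrix (Fin 3) (Fin 3) ℂ) :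
    Matrix (Fin 3 × St N) (Fin 3 × St N) ℂ := Matrix.of fun p q =>
  K p.1 q.1 * (if p.2 = q.2 then 1 else 0)

/-- The monodromy matrix `M^{(K)}(λ) = K_a R_{a,N}(λ−ξ_N) ⋯ R_{a,1}(λ−ξ_1)`. -/
def monodromy (η : ℂ) (ξ : Fin N → ℂ) (K : Matrix (Fin 3) (Fin 3) ℂ) (lam : ℂ) :
    Matrix (Fin 3 × St N) (Fin 3 × St N) ℂ :=
  Kaux K * ((List.ofFn fun n : Fin N => Raux η ξ lam n).reverse.prod)

/-- The transfer matrix `T₁^{(K)}(λ) = tr_a M^{(K)}(λ)`. -/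
def T1 (η : ℂ) (ξ : Fin N → ℂ) (K : Matrix (Fin 3) (Fin 3) ℂ) (lam : ℂ) : Op N :=
  Matrix.of fun f g => ∑ v : Fin 3, monodromy η ξ K lam (v, f) (v, g)

/-- Embedding of an (aux ⊗ H)-operator using the first of two auxiliary spaces. -/
def emb1 (M : Matrix (Fin 3 × St N) (Fin 3 × St N) ℂ) :
    Matrix ((Fin 3 × Fin 3) × St N) ((Fin 3 × Fin 3) × St N) ℂ := Matrix.of fun p q =>
  M (p.1.1, p.2) (q.1.1, q.2) * (if p.1.2 = q.1.2 then 1 else 0)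

/-- Embedding of an (aux ⊗ H)-operator using the second of two auxiliary spaces. -/
def emb2 (M : Matrix (Fin 3 × St N) (Fin 3 × St N) ℂ) :
    Matrix ((Fin 3 × Fin 3) × St N) ((Fin 3 × Fin 3) × St N) ℂ := Matrix.of fun p q =>
  M (p.1.2, p.2) (q.1.2, q.2) * (if p.1.1 = q.1.1 then 1 else 0)

/-- The antisymmetrizer `P⁻₁₂` on the two auxiliary spaces (acting trivially on `H`). -/
def antisym2 : Matrix ((Fin 3 × Fin 3) × St N) ((Fin 3 × Fin 3) × St N) ℂ :=
  Matrix.of fun p q =>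
    (if p.2 = q.2 then 1 else 0) *
      ((2 : ℂ)⁻¹ * ((if p.1 = q.1 then 1 else 0) - (if p.1 = (q.1.2, q.1.1) then 1 else 0)))

/-- The fused transfer matrix
`T₂^{(K)}(λ) = tr_{12} [P⁻₁₂ M₁^{(K)}(λ) M₂^{(K)}(λ−η)]`. -/
def T2 (η : ℂ) (ξ : Fin N → ℂ) (K : Matrix (Fin 3) (Fin 3) ℂ) (lam : ℂ) : Op N :=
  Matrix.of fun f g => ∑ v : Fin 3 × Fin 3,
    ((antisym2 * emb1 (monodromy η ξ K lam) * emb2 (monodromy η ξ K (lam - η)) :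
      Matrix ((Fin 3 × Fin 3) × St N) ((Fin 3 × Fin 3) × St N) ℂ)) (v, f) (v, g)

/-- A matrix has simple spectrum iff its minimal and characteristic polynomials coincide. -/
def SimpleSpectrum (K : Matrix (Fin 3) (Fin 3) ℂ) : Prop := minpoly ℂ K = K.charpoly

/-- The conserved-charge product `∏_n T₂^{(K)}(ξ_n−η)^{δ_{h_n,0}} T₁^{(K)}(ξ_n)^{δ_{h_n,2}}`
generating the SoV co-vector basis. -/
def sovCovOp (η : ℂ) (ξ : Fin N → ℂ) (K : Matrix (Fin 3) (Fin 3) ℂ) (h : St N) : Op N :=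
  (List.ofFn fun n : Fin N =>
    T2 η ξ K (ξ n - η) ^ (if h n = 0 then 1 else 0) *
      T1 η ξ K (ξ n) ^ (if h n = 2 then 1 else 0)).prod

/-- The SoV co-vector `⟨h| = ⟨1| ∏_n T₂^{(K)}(ξ_n−η)^{δ_{h_n,0}} T₁^{(K)}(ξ_n)^{δ_{h_n,2}}`. -/
def sovCov (η : ℂ) (ξ : Fin N → ℂ) (K : Matrix (Fin 3) (Fin 3) ℂ) (L : Hsp N) (h : St N) :
    Hsp N := Matrix.vecMul L (sovCovOp η ξ K h)

/-- The conserved-charge product `∏_n T₂^{(K)}(ξ_n)^{δ_{h_n,1}} T₁^{(K)}(ξ_n)^{δ_{h_n,2}}`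
generating the SoV vector basis. -/
def sovVecOp (η : ℂ) (ξ : Fin N → ℂ) (K : Matrix (Fin 3) (Fin 3) ℂ) (h : St N) : Op N :=
  (List.ofFn fun n : Fin N =>
    T2 η ξ K (ξ n) ^ (if h n = 1 then 1 else 0) *
      T1 η ξ K (ξ n) ^ (if h n = 2 then 1 else 0)).prod

/-- The SoV vector `|h⟩ = ∏_n T₂^{(K)}(ξ_n)^{δ_{h_n,1}} T₁^{(K)}(ξ_n)^{δ_{h_n,2}} |0⟩`. -/
def sovVec (η : ℂ) (ξ : Fin N → ℂ) (K : Matrix (Fin 3) (Fin 3) ℂ) (R0 : Hsp N) (h : St N) :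
    Hsp N := Matrix.mulVec (sovVecOp η ξ K h) R0

/-- Pairing ⟨L|v⟩ between a co-vector and a vector. -/
def pair (L v : Hsp N) : ℂ := ∑ f, L f * v f

/-- A family of `3^N` (co-)vectors is a basis of `H`. -/
def IsBasisFamily (v : St N → Hsp N) : Prop :=
  LinearIndependent ℂ v ∧ Submodule.span ℂ (Set.range v) = ⊤

/-- The label `(0,…,0)`. -/
def zeroSt : St N := fun _ => 0

/-- `R0` is the reference vector `|0⟩`, characterized by `⟨k|0⟩ = ∏_a δ_{k_a,0}`. -/
def DualRef (η : ℂ) (ξ : Fin N → ℂ) (K : Matrix (Fin 3) (Fin 3) ℂ) (L R0 : Hsp N) : Prop :=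
  ∀ k : St N, pair (sovCov η ξ K L k) R0 = if k = zeroSt then 1 else 0

/-- The diagonal SoV coupling `N_h`. -/
def Nh (η : ℂ) (ξ : Fin N → ℂ) (h : St N) : ℂ :=
  (∏ a, dfun ξ (ξ a - η) / dfun ξ (ξ a - ((1 : ℂ) + (if h a = 0 then 0 else 1)) * η)) *
    Vdm ξ ^ 2 /
      (Vdm (fun a => ξ a - (if h a = 0 then 0 else 1 : ℂ) * η) *
        Vdm (fun a => ξ a - (if h a = 2 then 1 else 0 : ℂ) * η))

/-- The 3×3 Jordan-type matrix with diagonal `(k₀,k₁,k₂)` and superdiagonal `(y₁,y₂)`. -/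
def KJmat (k₀ k₁ k₂ y₁ y₂ : ℂ) : Matrix (Fin 3) (Fin 3) ℂ := !![k₀, y₁, 0; 0, k₁, y₂; 0, 0, k₂]

/-- `W` conjugates `K` to its Jordan form with data `(k₀,k₁,k₂,y₁,y₂)`. -/
def JordanData (K W : Matrix (Fin 3) (Fin 3) ℂ) (k₀ k₁ k₂ y₁ y₂ : ℂ) : Prop :=
  IsUnit W.det ∧ K = W * KJmat k₀ k₁ k₂ y₁ y₂ * W⁻¹

/-- The tensor product co-vector `⟨L| = (⊗_a (x,y,z)_a)·Γ_W⁻¹`. -/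
def tensorCov (W : Matrix (Fin 3) (Fin 3) ℂ) (x y z : ℂ) : Hsp N :=
  fun f => ∏ a, Matrix.vecMul ![x, y, z] W⁻¹ (f a)

/-- The tensor product vector `|R⟩ = Γ_W·(⊗_a (r,s,t)_aᵗ)`. -/
def tensorVec (W : Matrix (Fin 3) (Fin 3) ℂ) (r s t : ℂ) : Hsp N :=
  fun f => ∏ a, Matrix.mulVec W ![r, s, t] (f a)

/-- `1_k = {a : k_a = 1}`. -/
def ones (k : St N) : Finset (Fin N) := Finset.univ.filter fun a => k a = 1

/-- `n_k = ⌊#1_k / 2⌋`. -/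
def nhalf (k : St N) : ℕ := (ones k).card / 2

/-- `k_{α,β}^{(0,2)}`: the label `k` with entries in `α` set to `0` and entries in `β` set to `2`. -/
def kab (k : St N) (α β : Finset (Fin N)) : St N :=
  fun a => if a ∈ α then 0 else if a ∈ β then 2 else k a

end
end SoV

namespace SoV
noncomputable section

open Matrix
open scoped Kronecker

section TensorMatrices

variable {R : Type*} [Ring R]

/-- The tensor product of two matrices whose entries are multiplied in the opposite order. -/
def opKronecker {I J : Type*} (A : Matrix I I R) (B : Matrix J J R) : Matrix (I × J) (I × J) R :=
  Matrix.of fun p q => B p.2 q.2 * A p.1 q.1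

theorem mul_kronecker_mul_of_commute {I J : Type*} [Fintype I] [Fintype J]
    {A A' : Matrix I I R} {B B' : Matrix J J R}
    (h : ∀ i j k l, Commute (A' i j) (B k l)) :
    (A * A') ⊗ₖ (B * B') = (A ⊗ₖ B) * (A' ⊗ₖ B') := by
  ext ⟨i, k⟩ ⟨j, l⟩
  simp only [kronecker_apply, mul_apply, Finset.sum_mul_sum, Fintype.sum_prod_type]
  refine Finset.sum_congr rfl fun p _ => Finset.sum_congr rfl fun q _ => ?_
  rw [mul_assoc, ← mul_assoc (A' p j), (h p j k q).eq]
  simp only [mul_assoc]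

theorem mul_opKronecker_mul_of_commute {I J : Type*} [Fintype I] [Fintype J]
    {A A' : Matrix I I R} {B B' : Matrix J J R}
    (h : ∀ i j k l, Commute (A i j) (B' k l)) :
    opKronecker (A * A') (B * B') = opKronecker A B * opKronecker A' B' := by
  ext ⟨i, k⟩ ⟨j, l⟩
  simp only [opKronecker, of_apply, mul_apply, Finset.sum_mul_sum, Fintype.sum_prod_type]
  rw [Finset.sum_comm]
  refine Finset.sum_congr rfl fun p _ => Finset.sum_congr rfl fun q _ => ?_
  rw [mul_assoc, ← mul_assoc (B' q l), ← (h i p q l).eq]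
  simp only [mul_assoc]

/-- The permutation operator on two copies of the auxiliary space. -/
def swapMat : Matrix (Fin 3 × Fin 3) (Fin 3 × Fin 3) R :=
  Matrix.of fun p q => if p.swap = q then 1 else 0

theorem swapMat_mul_apply (X : Matrix (Fin 3 × Fin 3) (Fin 3 × Fin 3) R) (p q : Fin 3 × Fin 3) :
    (swapMat * X : Matrix (Fin 3 × Fin 3) (Fin 3 × Fin 3) R) p q = X p.swap q := by
  simp [swapMat, mul_apply]

theorem mul_swapMat_apply (X : Matrix (Fin 3 × Fin 3) (Fin 3 × Fin 3) R) (p q : Fin 3 × Fin 3) :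
    (X * swapMat : Matrix (Fin 3 × Fin 3) (Fin 3 × Fin 3) R) p q = X p q.swap := by
  have (r : Fin 3 × Fin 3) : r.swap = q ↔ r = q.swap := by
    constructor <;> rintro rfl <;> simp
  simp [swapMat, mul_apply, this]

theorem swapMat_mul_swapMat : (swapMat * swapMat : Matrix (Fin 3 × Fin 3) (Fin 3 × Fin 3) R) = 1 := by
  ext p q
  rw [swapMat_mul_apply]
  simp [swapMat, one_apply]

theorem one_add_swapMat_mul_one_sub_swapMat :
    ((1 + swapMat) * (1 - swapMat) : Matrix (Fin 3 × Fin 3) (Fin 3 × Fin 3) R) = 0 := by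
  rw [add_mul, mul_sub, mul_sub, swapMat_mul_swapMat]
  simp

theorem trace_mul_trace (A B : Matrix (Fin 3) (Fin 3) R) :
    A.trace * B.trace = ∑ i, ∑ j, A i i * B j j := by
  simp [Matrix.trace, Finset.sum_mul_sum]

variable [Algebra ℂ R]

/-- The exchange relation `R₁₂(c) A₁ B₂ = B₂ A₁ R₁₂(c)` for `R₁₂(c) = c + η P₁₂`. -/
def RTT (η c : ℂ) (A B : Matrix (Fin 3) (Fin 3) R) : Prop :=
  (c • 1 + η • swapMat) * (A ⊗ₖ B) = opKronecker A B * (c • 1 + η • swapMat)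

theorem RTT_iff {η c : ℂ} {A B : Matrix (Fin 3) (Fin 3) R} :
    RTT η c A B ↔ ∀ i j k l, c • (A i j * B k l) + η • (A k j * B i l) =
      c • (B k l * A i j) + η • (B k j * A i l) := by
  constructor
  · intro h i j k l
    have := congrFun (congrFun h (i, k)) (j, l)
    simpa [add_mul, mul_add, swapMat_mul_apply, mul_swapMat_apply, opKronecker] using this
  · intro h
    ext ⟨i, k⟩ ⟨j, l⟩
    simpa [add_mul, mul_add, swapMat_mul_apply, mul_swapMat_apply, opKronecker] using h i j k l

theorem RTT.mul {η c : ℂ} {A A' B B' : Matrix (Fin 3) (Fin 3) R}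
    (h : RTT η c A B) (h' : RTT η c A' B')
    (hA : ∀ i j k l, Commute (A' i j) (B k l)) (hB : ∀ i j k l, Commute (A i j) (B' k l)) :
    RTT η c (A * A') (B * B') := by
  unfold RTT at *
  rw [mul_kronecker_mul_of_commute hA, mul_opKronecker_mul_of_commute hB, ← mul_assoc, h,
    mul_assoc, h', mul_assoc]

theorem RTT.one_add_swapMat_mul {η : ℂ} (hη : η ≠ 0) {A B : Matrix (Fin 3) (Fin 3) R}
    (h : RTT η η A B) :
    (1 + swapMat) * (A ⊗ₖ B) = opKronecker A B * (1 + swapMat) := by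
  unfold RTT at h
  rw [← smul_add, smul_mul_assoc, mul_smul_comm] at h
  exact smul_right_injective _ hη h

theorem RTT.kronecker_mul_one_sub_swapMat {η : ℂ} (hη : η ≠ 0) {A B : Matrix (Fin 3) (Fin 3) R}
    (h : RTT η η A B) :
    (A ⊗ₖ B) * (1 - swapMat) = (1 - swapMat) * ((2 : ℂ)⁻¹ • ((A ⊗ₖ B) * (1 - swapMat))) := by
  have h0 : (1 + swapMat) * ((A ⊗ₖ B) * (1 - swapMat)) = 0 := by
    rw [← mul_assoc, h.one_add_swapMat_mul hη, mul_assoc, one_add_swapMat_mul_one_sub_swapMat,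
      mul_zero]
  set X := (A ⊗ₖ B) * (1 - swapMat)
  have h1 : swapMat * X = -X := by
    rw [add_mul, one_mul] at h0
    exact eq_neg_of_add_eq_zero_right h0
  rw [mul_smul_comm, sub_mul, h1, one_mul]
  module

theorem RTT.commute_trace {η c : ℂ} {A B : Matrix (Fin 3) (Fin 3) R}
    (h : RTT η c A B) (hc : c ^ 2 ≠ η ^ 2) : Commute A.trace B.trace := by
  rw [RTT_iff] at h
  have h1 : ∑ i, ∑ k, (c • (A i i * B k k) + η • (A k i * B i k)) =
      ∑ i, ∑ k, (c • (B k k * A i i) + η • (B k i * A i k)) :=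
    Finset.sum_congr rfl fun i _ => Finset.sum_congr rfl fun k _ => h i i k k
  have h2 : ∑ i, ∑ k, (c • (A k i * B i k) + η • (A i i * B k k)) =
      ∑ i, ∑ k, (c • (B i k * A k i) + η • (B i i * A k k)) :=
    Finset.sum_congr rfl fun i _ => Finset.sum_congr rfl fun k _ => h k i i k
  have e1 : A.trace * B.trace = ∑ i, ∑ k, A i i * B k k := by
    simp [Matrix.trace, Finset.sum_mul_sum]
  have e2 : B.trace * A.trace = ∑ i, ∑ k, B k k * A i i := by
    rw [Finset.sum_comm]
    simp [Matrix.trace, Finset.sum_mul_sum]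
  have e2' : B.trace * A.trace = ∑ i, ∑ k, B i i * A k k := by
    simp [Matrix.trace, Finset.sum_mul_sum]
  have e3 : ∑ i, ∑ k, B i k * A k i = ∑ i, ∑ k, B k i * A i k := Finset.sum_comm
  simp only [Finset.sum_add_distrib, ← Finset.smul_sum] at h1 h2
  rw [← e1, ← e2] at h1
  rw [← e1, ← e2', e3] at h2
  have h3 : (c ^ 2 - η ^ 2) • (A.trace * B.trace - B.trace * A.trace) = 0 := by
    linear_combination (norm := module) c • h1 - η • h2
  exact sub_eq_zero.1 ((smul_eq_zero.1 h3).resolve_left (sub_ne_zero.2 hc))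

/-- The partial trace of `P⁻₁₂ A₁ B₂`. -/
def fusedTrace (A B : Matrix (Fin 3) (Fin 3) R) : R :=
  (2 : ℂ)⁻¹ • ∑ i, ∑ j, (A i i * B j j - A j i * B i j)

theorem fusedTrace_eq_trace_mul_trace {A B : Matrix (Fin 3) (Fin 3) R}
    (h : (1 + swapMat) * (A ⊗ₖ B) = 0) : fusedTrace A B = A.trace * B.trace := by
  have h1 (i j : Fin 3) : A i i * B j j - A j i * B i j = (2 : ℂ) • (A i i * B j j) := by
    have := congrFun (congrFun h (i, j)) (i, j)
    rw [add_mul, one_mul, Matrix.add_apply, swapMat_mul_apply] at this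
    have := eq_neg_of_add_eq_zero_right this
    simp only [Prod.swap_prod_mk, kronecker_apply] at this
    rw [this]
    module
  simp_rw [fusedTrace, h1, ← Finset.smul_sum, trace_mul_trace]
  module

theorem fusedTrace_eq_zero {A B : Matrix (Fin 3) (Fin 3) R}
    (h : (A ⊗ₖ B) * (1 - swapMat) = 0) : fusedTrace A B = 0 := by
  have h1 (i j : Fin 3) : A i i * B j j = A i j * B j i := by
    have := congrFun (congrFun h (i, j)) (i, j)
    rw [mul_sub, mul_one, Matrix.sub_apply, mul_swapMat_apply] at this
    simpa [sub_eq_zero] using this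
  rw [fusedTrace]
  have h2 : ∑ i, ∑ j, A i i * B j j = ∑ i, ∑ j, A j i * B i j := by
    rw [Finset.sum_comm]
    exact Finset.sum_congr rfl fun i _ => Finset.sum_congr rfl fun j _ => h1 j i
  simp_rw [Finset.sum_sub_distrib]
  rw [h2, sub_self, smul_zero]

/-- The Levi-Civita symbol. -/
def leviCivita (p : Fin 3 × Fin 3 × Fin 3) : ℤ :=
  ((p.2.1 : ℤ) - p.1) * ((p.2.2 : ℤ) - p.1) * ((p.2.2 : ℤ) - p.2.1) / 2

/-- The completely antisymmetric vector of three auxiliary spaces. -/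
def epsVec (R : Type*) [Ring R] (p : Fin 3 × Fin 3 × Fin 3) : R := leviCivita p

/-- The completely antisymmetric vector is an eigenvector of `A₁ B₂ C₃` with the scalar `q`. -/
def HasQDet (q : ℂ) (A B C : Matrix (Fin 3) (Fin 3) R) : Prop :=
  (A ⊗ₖ (B ⊗ₖ C)) *ᵥ epsVec R = q • epsVec R

theorem hasQDet_iff {q : ℂ} {A B C : Matrix (Fin 3) (Fin 3) R} :
    HasQDet q A B C ↔ ∀ i j k,
      A i 0 * (B j 1 * C k 2) - A i 0 * (B j 2 * C k 1) - A i 1 * (B j 0 * C k 2) +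
        A i 1 * (B j 2 * C k 0) + A i 2 * (B j 0 * C k 1) - A i 2 * (B j 1 * C k 0) =
      (q * leviCivita (i, j, k)) • 1 := by
  have h1 (i j k : Fin 3) : ((A ⊗ₖ (B ⊗ₖ C)) *ᵥ epsVec R) (i, j, k) =
      A i 0 * (B j 1 * C k 2) - A i 0 * (B j 2 * C k 1) - A i 1 * (B j 0 * C k 2) +
        A i 1 * (B j 2 * C k 0) + A i 2 * (B j 0 * C k 1) - A i 2 * (B j 1 * C k 0) := by
    norm_num [mulVec, dotProduct, epsVec, leviCivita, Fintype.sum_prod_type, Fin.sum_univ_three]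
    abel
  have h2 (i j k : Fin 3) : (q • epsVec R) (i, j, k) = (q * leviCivita (i, j, k)) • 1 := by
    rw [mul_smul, Pi.smul_apply, epsVec, Int.cast_smul_eq_zsmul, zsmul_one]
  simp only [HasQDet, funext_iff, Prod.forall, h1, h2]

theorem HasQDet.mul {q q' : ℂ} {A A' B B' C C' : Matrix (Fin 3) (Fin 3) R}
    (h : HasQDet q A B C) (h' : HasQDet q' A' B' C')
    (hAB : ∀ i j k l, Commute (A' i j) (B k l)) (hAC : ∀ i j k l, Commute (A' i j) (C k l))
    (hBC : ∀ i j k l, Commute (B' i j) (C k l)) :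
    HasQDet (q * q') (A * A') (B * B') (C * C') := by
  unfold HasQDet at *
  rw [mul_kronecker_mul_of_commute hBC, mul_kronecker_mul_of_commute, ← mulVec_mulVec, h',
    mulVec_smul, h, smul_smul, mul_comm]
  intro i j k l
  exact (hAB _ _ _ _).mul_right (hAC _ _ _ _)

theorem trace_mul_fusedTrace {q : ℂ} {A B C : Matrix (Fin 3) (Fin 3) R}
    (hAB : (1 + swapMat) * (A ⊗ₖ B) = 0)
    (hBC : (1 + swapMat) * ((B ⊗ₖ C) * (1 - swapMat)) = 0)
    (hq : HasQDet q A B C) : A.trace * fusedTrace B C = q • 1 := by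
  set X : Fin 3 → Fin 3 → Fin 3 → Fin 3 → Fin 3 → Fin 3 → R := fun i j k l m n =>
    A i l * (B j m * C k n - B j n * C k m) with hX
  have h1 (i j k l m n) : X j i k l m n = - X i j k l m n := by
    have hr (p : Fin 3) : A j l * B i p = - (A i l * B j p) := by
      have := congrFun (congrFun hAB (i, j)) (l, p)
      rw [add_mul, one_mul, Matrix.add_apply, swapMat_mul_apply] at this
      exact eq_neg_of_add_eq_zero_right this
    simp only [hX, mul_sub, ← mul_assoc, hr]
    noncomm_ring
  have h2 (i j k l m n) : X i k j l m n = - X i j k l m n := by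
    have := congrFun (congrFun hBC (j, k)) (m, n)
    rw [add_mul, one_mul, Matrix.add_apply, swapMat_mul_apply, mul_sub, mul_one,
      Matrix.sub_apply, Matrix.sub_apply, mul_swapMat_apply, mul_swapMat_apply] at this
    have := eq_neg_of_add_eq_zero_right this
    simp only [Prod.swap_prod_mk, kronecker_apply] at this
    simp only [hX, this, mul_neg]
  have h3 {x : R} (h : x = -x) : x = 0 := by
    have : (2 : ℂ) • x = 0 := by rw [two_smul]; nth_rw 1 [h]; simp
    exact (smul_eq_zero.1 this).resolve_left two_ne_zero
  have h4 (i j k l m n) : X i j k l m n = leviCivita (i, j, k) • X 0 1 2 l m n := by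
    have e1 (i k) : X i i k l m n = 0 := h3 (h1 i i k l m n)
    have e2 (i k) : X i k k l m n = 0 := h3 (h2 i k k l m n)
    have e3 (i k) : X i k i l m n = 0 := by rw [h2, e1, neg_zero]
    have e4 : X 1 0 2 l m n = - X 0 1 2 l m n := h1 ..
    have e5 : X 0 2 1 l m n = - X 0 1 2 l m n := h2 ..
    have e6 : X 1 2 0 l m n = X 0 1 2 l m n := by rw [h2, e4, neg_neg]
    have e7 : X 2 0 1 l m n = X 0 1 2 l m n := by rw [h1, e5, neg_neg]
    have e8 : X 2 1 0 l m n = - X 0 1 2 l m n := by rw [h1, e6]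
    clear_value X
    fin_cases i <;> fin_cases j <;> fin_cases k <;>
      simp [leviCivita, e1, e2, e3, e4, e5, e6, e7, e8]
  have h5 : A.trace * fusedTrace B C = (2 : ℂ)⁻¹ • ∑ i, ∑ j, ∑ k, X i j k i j k := by
    simp only [fusedTrace, Matrix.trace_fin_three, Fin.sum_univ_three, hX, mul_smul_comm, add_mul,
      mul_add, mul_sub]
    congr 1
    abel
  have h6 := hasQDet_iff.1 hq 0 1 2
  rw [h5, Finset.sum_congr rfl fun i _ => Finset.sum_congr rfl fun j _ =>
    Finset.sum_congr rfl fun k _ => h4 i j k i j k]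
  have e : leviCivita (0, 1, 2) = 1 := rfl
  rw [e, Int.cast_one, mul_one] at h6
  rw [← h6]
  simp only [Fin.sum_univ_three, leviCivita]
  simp only [hX]
  norm_num [mul_sub]
  module

theorem hasQDet_map_algebraMap (K : Matrix (Fin 3) (Fin 3) ℂ) :
    HasQDet K.det (K.map (algebraMap ℂ R)) (K.map (algebraMap ℂ R)) (K.map (algebraMap ℂ R)) := by
  rw [hasQDet_iff]
  intro i j k
  rw [Matrix.det_fin_three, ← Algebra.algebraMap_eq_smul_one]
  simp only [Matrix.map_apply, ← map_mul, ← map_sub, ← map_add]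
  congr 1
  fin_cases i <;> fin_cases j <;> fin_cases k <;> simp [leviCivita] <;> ring

/-- The Lax operator `x + η E` built from the matrix of generators `E`. -/
def laxMat (η x : ℂ) (E : Matrix (Fin 3) (Fin 3) R) : Matrix (Fin 3) (Fin 3) R :=
  x • 1 + η • E

section Lax

variable {E : Matrix (Fin 3) (Fin 3) R}

theorem RTT_laxMat (hE : ∀ i j k l, E i j * E k l = if i = l then E k j else 0) (η x y : ℂ) :
    RTT η (x - y) (laxMat η x E) (laxMat η y E) := by
  rw [RTT_iff]
  intro i j k l
  simp only [laxMat, Matrix.add_apply, Matrix.smul_apply, add_mul, mul_add, smul_mul_assoc,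
    mul_smul_comm, hE, Matrix.one_apply, ite_mul, mul_ite]
  split_ifs <;> simp <;> module

theorem one_add_swapMat_mul_laxMat (hE : ∀ i j k l, E i j * E k l = if i = l then E k j else 0)
    (η : ℂ) : (1 + swapMat) * (laxMat η 0 E ⊗ₖ laxMat η (-η) E) = 0 := by
  ext ⟨i, k⟩ ⟨j, l⟩
  rw [add_mul, one_mul, Matrix.add_apply, swapMat_mul_apply]
  simp only [laxMat, Matrix.add_apply, Matrix.smul_apply, add_mul, mul_add, smul_mul_assoc,
    mul_smul_comm, hE, Matrix.one_apply, kronecker_apply,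
    Prod.swap_prod_mk]
  split_ifs <;> simp

theorem laxMat_mul_one_sub_swapMat (hE : ∀ i j k l, E i j * E k l = if i = l then E k j else 0)
    (η : ℂ) : (laxMat η η E ⊗ₖ laxMat η 0 E) * (1 - swapMat) = 0 := by
  ext ⟨i, k⟩ ⟨j, l⟩
  rw [mul_sub, mul_one, Matrix.sub_apply, mul_swapMat_apply]
  simp only [laxMat, Matrix.add_apply, Matrix.smul_apply, add_mul, mul_add, smul_mul_assoc,
    mul_smul_comm, hE, Matrix.one_apply, kronecker_apply,
    Prod.swap_prod_mk]
  split_ifs <;> simp <;> module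

theorem hasQDet_laxMat (hE : ∀ i j k l, E i j * E k l = if i = l then E k j else 0)
    (hE1 : E.trace = 1) (η x : ℂ) :
    HasQDet ((x + η) * (x - η) * (x - 2 * η)) (laxMat η x E) (laxMat η (x - η) E)
      (laxMat η (x - 2 * η) E) := by
  have h2 : E 2 2 = 1 - E 0 0 - E 1 1 := by
    rw [← hE1, Matrix.trace_fin_three]
    abel
  rw [hasQDet_iff]
  intro i j k
  fin_cases i <;> fin_cases j <;> fin_cases k <;>
    simp [leviCivita, laxMat, add_mul, mul_add, hE, h2, mul_sub, sub_mul] <;>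
    module

end Lax

end TensorMatrices

section Chain

variable {N : ℕ}

/-- The matrix units of the `n`-th site of the chain, arranged as the permutation operator. -/
def siteMat (n : Fin N) : Matrix (Fin 3) (Fin 3) (Op N) :=
  Matrix.of fun i j => Matrix.of fun f g => if i = g n ∧ f = Function.update g n j then 1 else 0

theorem siteMat_apply (n : Fin N) (i j : Fin 3) (f g : St N) :
    siteMat n i j f g = if i = g n ∧ f = Function.update g n j then 1 else 0 := rfl

theorem siteMat_mul_apply (n m : Fin N) (i j k l : Fin 3) (f g : St N) :
    (siteMat n i j * siteMat m k l) f g =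
      if k = g m ∧ i = Function.update g m l n ∧
        f = Function.update (Function.update g m l) n j then 1 else 0 := by
  rw [Matrix.mul_apply, Finset.sum_eq_single (Function.update g m l)]
  · simp only [siteMat_apply]
    split_ifs <;> simp_all
  · intro b _ hb
    simp [siteMat_apply, hb]
  · simp

theorem siteMat_mul_self (n : Fin N) (i j k l : Fin 3) :
    siteMat n i j * siteMat n k l = if i = l then siteMat n k j else 0 := by
  ext f g
  rw [siteMat_mul_apply]
  split_ifs <;> simp_all [siteMat_apply]

theorem commute_siteMat {n m : Fin N} (h : n ≠ m) (i j k l : Fin 3) :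
    Commute (siteMat n i j) (siteMat m k l) := by
  ext f g
  rw [siteMat_mul_apply, siteMat_mul_apply, Function.update_of_ne h, Function.update_of_ne h.symm,
    Function.update_comm h]
  congr 1
  exact propext and_left_comm

theorem trace_siteMat (n : Fin N) : (siteMat n).trace = 1 := by
  ext f g
  simp only [Matrix.trace, Matrix.diag_apply, Matrix.sum_apply, siteMat_apply]
  rw [Finset.sum_eq_single (g n)]
  · simp [Matrix.one_apply]
  · intro b _ hb
    simp [hb]
  · simp

/-- The Lax operator of the `n`-th site. -/
def laxOp (η : ℂ) (ξ : Fin N → ℂ) (lam : ℂ) (n : Fin N) : Matrix (Fin 3) (Fin 3) (Op N) :=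
  laxMat η (lam - ξ n) (siteMat n)

/-- The product of the Lax operators along a list of sites. -/
def chainProd (η : ℂ) (ξ : Fin N → ℂ) (l : List (Fin N)) (lam : ℂ) :
    Matrix (Fin 3) (Fin 3) (Op N) :=
  (l.map (laxOp η ξ lam)).prod

/-- The monodromy matrix as a `3 × 3` matrix of operators on the chain. -/
def monoMat (η : ℂ) (ξ : Fin N → ℂ) (K : Matrix (Fin 3) (Fin 3) ℂ) (lam : ℂ) :
    Matrix (Fin 3) (Fin 3) (Op N) :=
  K.map (algebraMap ℂ (Op N)) * chainProd η ξ (List.finRange N).reverse lam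

theorem monodromy_eq (η : ℂ) (ξ : Fin N → ℂ) (K : Matrix (Fin 3) (Fin 3) ℂ) (lam : ℂ) :
    monodromy η ξ K lam = Matrix.compRingEquiv (Fin 3) (St N) ℂ (monoMat η ξ K lam) := by
  have hK : Kaux K = Matrix.compRingEquiv (Fin 3) (St N) ℂ (K.map (algebraMap ℂ (Op N))) := by
    ext ⟨i, f⟩ ⟨j, g⟩
    simp [Kaux, Matrix.compRingEquiv, Matrix.algebraMap_matrix_apply]
  have hR (n : Fin N) : Raux η ξ lam n =
      Matrix.compRingEquiv (Fin 3) (St N) ℂ (laxOp η ξ lam n) := by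
    ext ⟨i, f⟩ ⟨j, g⟩
    by_cases hij : i = j <;>
    simp [Raux, Matrix.compRingEquiv, laxOp, laxMat, siteMat_apply, Matrix.one_apply, hij]
  rw [monodromy, monoMat, map_mul, hK, chainProd, map_list_prod, List.map_map,
    List.ofFn_eq_map, List.map_reverse]
  simp_rw [hR]
  rfl

theorem monodromy_apply (η : ℂ) (ξ : Fin N → ℂ) (K : Matrix (Fin 3) (Fin 3) ℂ) (lam : ℂ)
    (i j : Fin 3) (f g : St N) :
    monodromy η ξ K lam (i, f) (j, g) = monoMat η ξ K lam i j f g := by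
  rw [monodromy_eq]
  rfl

theorem T1_eq_trace (η : ℂ) (ξ : Fin N → ℂ) (K : Matrix (Fin 3) (Fin 3) ℂ) (lam : ℂ) :
    T1 η ξ K lam = (monoMat η ξ K lam).trace := by
  ext f g
  simp [T1, monodromy_apply, Matrix.trace, Matrix.sum_apply]

theorem emb1_mul_emb2_apply (A B : Matrix (Fin 3 × St N) (Fin 3 × St N) ℂ)
    (i k j l : Fin 3) (f g : St N) :
    (emb1 A * emb2 B) ((i, k), f) ((j, l), g) = ∑ e, A (i, f) (j, e) * B (k, e) (l, g) := by
  rw [Matrix.mul_apply, Fintype.sum_prod_type, Finset.sum_eq_single (j, k)]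
  · simp [emb1, emb2]
  · rintro ⟨p, q⟩ _ h
    refine Finset.sum_eq_zero fun e _ => ?_
    simp only [emb1, emb2, Matrix.of_apply]
    split_ifs with h1 h2 <;> simp_all
  · simp

theorem antisym2_mul_apply (X : Matrix ((Fin 3 × Fin 3) × St N) ((Fin 3 × Fin 3) × St N) ℂ)
    (p q : Fin 3 × Fin 3) (f g : St N) :
    (antisym2 * X : Matrix ((Fin 3 × Fin 3) × St N) ((Fin 3 × Fin 3) × St N) ℂ) (p, f) (q, g) =
      2⁻¹ * (X (p, f) (q, g) - X (p.swap, f) (q, g)) := by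
  have hp (r : Fin 3 × Fin 3) : p = (r.2, r.1) ↔ p.swap = r := by
    constructor <;> rintro rfl <;> rfl
  have h1 (r : Fin 3 × Fin 3) : ∑ e, antisym2 (p, f) (r, e) * X (r, e) (q, g) =
      2⁻¹ * ((if p = r then X (r, f) (q, g) else 0) -
        (if p.swap = r then X (r, f) (q, g) else 0)) := by
    simp [antisym2, hp, mul_assoc, sub_mul]
  rw [Matrix.mul_apply, Fintype.sum_prod_type, Finset.sum_congr rfl fun r _ => h1 r,
    ← Finset.mul_sum, Finset.sum_sub_distrib]
  simp

theorem T2_eq_fusedTrace (η : ℂ) (ξ : Fin N → ℂ) (K : Matrix (Fin 3) (Fin 3) ℂ) (lam : ℂ) :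
    T2 η ξ K lam = fusedTrace (monoMat η ξ K lam) (monoMat η ξ K (lam - η)) := by
  ext f g
  rw [T2, Matrix.of_apply, Matrix.mul_assoc]
  simp only [antisym2_mul_apply, Prod.swap, emb1_mul_emb2_apply, monodromy_apply,
    Fintype.sum_prod_type]
  simp only [fusedTrace, Matrix.smul_apply, Matrix.sum_apply, Matrix.sub_apply,
    Matrix.mul_apply, smul_eq_mul, Finset.mul_sum]

theorem commute_laxOp (η : ℂ) (ξ : Fin N → ℂ) (u v : ℂ) {n m : Fin N} (h : n ≠ m)
    (i j k l : Fin 3) : Commute (laxOp η ξ u n i j) (laxOp η ξ v m k l) := by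
  have hone (w : ℂ) (p q : Fin 3) : (w • (1 : Matrix (Fin 3) (Fin 3) (Op N))) p q =
      algebraMap ℂ (Op N) (if p = q then w else 0) := by
    rw [Algebra.algebraMap_eq_smul_one, Matrix.smul_apply, Matrix.one_apply]
    split_ifs <;> simp
  simp only [laxOp, laxMat, Matrix.add_apply, hone]
  refine ((Algebra.commute_algebraMap_left _ _).add_left ?_)
  refine (Algebra.commute_algebraMap_right _ _).add_right ?_
  exact ((commute_siteMat h i j k l).smul_left η).smul_right η

theorem commute_laxOp_chainProd (η : ℂ) (ξ : Fin N → ℂ) (u v : ℂ) {n : Fin N}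
    {s : List (Fin N)} (h : n ∉ s) (i j k l : Fin 3) :
    Commute (laxOp η ξ u n i j) (chainProd η ξ s v k l) := by
  induction s generalizing k l with
  | nil =>
    simp only [chainProd, List.map_nil, List.prod_nil, Matrix.one_apply]
    split_ifs <;> simp
  | cons m s ih =>
    rw [List.mem_cons, not_or] at h
    simp only [chainProd, List.map_cons, List.prod_cons, Matrix.mul_apply]
    exact Commute.sum_right _ _ _ fun p _ =>
      (commute_laxOp η ξ u v h.1 i j k p).mul_right (ih h.2 p l)

theorem chainProd_cons (η : ℂ) (ξ : Fin N → ℂ) (n : Fin N) (s : List (Fin N)) (lam : ℂ) :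
    chainProd η ξ (n :: s) lam = laxOp η ξ lam n * chainProd η ξ s lam := by
  simp [chainProd]

theorem RTT_laxOp (η : ℂ) (ξ : Fin N → ℂ) (u v : ℂ) (n : Fin N) :
    RTT η (u - v) (laxOp η ξ u n) (laxOp η ξ v n) := by
  have := RTT_laxMat (siteMat_mul_self n) η (u - ξ n) (v - ξ n)
  rwa [sub_sub_sub_cancel_right] at this

theorem kronecker_chainProd_cons (η : ℂ) (ξ : Fin N → ℂ) (u v : ℂ) {n : Fin N}
    {s : List (Fin N)} (h : n ∉ s) :
    chainProd η ξ (n :: s) u ⊗ₖ chainProd η ξ (n :: s) v =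
      (laxOp η ξ u n ⊗ₖ laxOp η ξ v n) * (chainProd η ξ s u ⊗ₖ chainProd η ξ s v) := by
  rw [chainProd_cons, chainProd_cons]
  exact mul_kronecker_mul_of_commute fun i j k l => (commute_laxOp_chainProd η ξ v u h k l i j).symm

theorem RTT_chainProd (η : ℂ) (ξ : Fin N → ℂ) (u v : ℂ) {s : List (Fin N)} (hs : s.Nodup) :
    RTT η (u - v) (chainProd η ξ s u) (chainProd η ξ s v) := by
  induction s with
  | nil =>
    rw [RTT_iff]
    intro i j k l
    simp only [chainProd, List.map_nil, List.prod_nil, Matrix.one_apply]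
    split_ifs <;> simp
  | cons n s ih =>
    rw [List.nodup_cons] at hs
    rw [chainProd_cons, chainProd_cons]
    exact (RTT_laxOp η ξ u v n).mul (ih hs.2)
      (fun i j k l => (commute_laxOp_chainProd η ξ v u hs.1 k l i j).symm)
      (fun i j k l => commute_laxOp_chainProd η ξ u v hs.1 i j k l)

theorem one_add_swapMat_mul_chainProd {η : ℂ} (hη : η ≠ 0) (ξ : Fin N → ℂ) (b : Fin N)
    {s : List (Fin N)} (hs : s.Nodup) (hb : b ∈ s) :
    (1 + swapMat) * (chainProd η ξ s (ξ b) ⊗ₖ chainProd η ξ s (ξ b - η)) = 0 := by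
  induction s with
  | nil => simp at hb
  | cons n s ih =>
    rw [List.nodup_cons] at hs
    rw [kronecker_chainProd_cons η ξ _ _ hs.1, ← mul_assoc]
    by_cases hn : b = n
    · have := one_add_swapMat_mul_laxMat (siteMat_mul_self b) η
      rw [← hn, laxOp, laxOp, sub_self, sub_right_comm, sub_self, zero_sub, this, zero_mul]
    · have h := RTT_laxOp η ξ (ξ b) (ξ b - η) n
      rw [sub_sub_cancel] at h
      rw [h.one_add_swapMat_mul hη, mul_assoc, ih hs.2 ((List.mem_cons.1 hb).resolve_left hn),
        mul_zero]

theorem chainProd_mul_one_sub_swapMat {η : ℂ} (hη : η ≠ 0) (ξ : Fin N → ℂ) (b : Fin N)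
    {s : List (Fin N)} (hs : s.Nodup) (hb : b ∈ s) :
    (chainProd η ξ s (ξ b + η) ⊗ₖ chainProd η ξ s (ξ b)) * (1 - swapMat) = 0 := by
  induction s with
  | nil => simp at hb
  | cons n s ih =>
    rw [List.nodup_cons] at hs
    rw [kronecker_chainProd_cons η ξ _ _ hs.1, mul_assoc]
    by_cases hn : b = n
    · have h := RTT_chainProd η ξ (ξ b + η) (ξ b) hs.2
      rw [add_sub_cancel_left] at h
      have h1 := laxMat_mul_one_sub_swapMat (siteMat_mul_self b) η
      rw [h.kronecker_mul_one_sub_swapMat hη, ← mul_assoc, ← hn, laxOp, laxOp, sub_self,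
        add_sub_cancel_left, h1, zero_mul]
    · rw [ih hs.2 ((List.mem_cons.1 hb).resolve_left hn), mul_zero]

theorem exists_hasQDet_chainProd (η : ℂ) (ξ : Fin N → ℂ) (u : ℂ) {s : List (Fin N)}
    (hs : s.Nodup) : ∃ q : ℂ, HasQDet q (chainProd η ξ s u) (chainProd η ξ s (u - η))
      (chainProd η ξ s (u - 2 * η)) := by
  induction s with
  | nil =>
    have := hasQDet_map_algebraMap (R := Op N) 1
    rw [Matrix.map_one _ (map_zero _) (map_one _)] at this
    exact ⟨_, this⟩
  | cons n s ih =>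
    rw [List.nodup_cons] at hs
    obtain ⟨q, hq⟩ := ih hs.2
    have h := hasQDet_laxMat (siteMat_mul_self n) (trace_siteMat n) η (u - ξ n)
    have hc (v w : ℂ) (i j k l : Fin 3) :
        Commute (chainProd η ξ s v i j) (laxOp η ξ w n k l) :=
      (commute_laxOp_chainProd η ξ w v hs.1 k l i j).symm
    simp only [chainProd_cons]
    rw [sub_right_comm u (ξ n) η, sub_right_comm u (ξ n) (2 * η)] at h
    exact ⟨_, HasQDet.mul h hq (hc _ _) (hc _ _) (hc _ _)⟩

theorem commute_map_algebraMap (K : Matrix (Fin 3) (Fin 3) ℂ) (x : Op N) (i j : Fin 3) :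
    Commute (K.map (algebraMap ℂ (Op N)) i j) x := by
  rw [Matrix.map_apply]
  exact Algebra.commutes _ _

theorem RTT_map_algebraMap (η c : ℂ) (K : Matrix (Fin 3) (Fin 3) ℂ) :
    RTT η c (K.map (algebraMap ℂ (Op N))) (K.map (algebraMap ℂ (Op N))) := by
  rw [RTT_iff]
  intro i j k l
  rw [(commute_map_algebraMap K _ i j).eq, (commute_map_algebraMap K _ k j).eq]

theorem nodup_sites : (List.finRange N).reverse.Nodup :=
  List.nodup_reverse.2 (List.nodup_finRange N)

theorem mem_sites (b : Fin N) : b ∈ (List.finRange N).reverse :=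
  List.mem_reverse.2 (List.mem_finRange b)

theorem kronecker_monoMat (η : ℂ) (ξ : Fin N → ℂ) (K : Matrix (Fin 3) (Fin 3) ℂ) (u v : ℂ) :
    monoMat η ξ K u ⊗ₖ monoMat η ξ K v =
      (K.map (algebraMap ℂ (Op N)) ⊗ₖ K.map (algebraMap ℂ (Op N))) *
        (chainProd η ξ (List.finRange N).reverse u ⊗ₖ
          chainProd η ξ (List.finRange N).reverse v) :=
  mul_kronecker_mul_of_commute fun _ _ k l => (commute_map_algebraMap K _ k l).symm

theorem RTT_monoMat (η : ℂ) (ξ : Fin N → ℂ) (K : Matrix (Fin 3) (Fin 3) ℂ) (u v : ℂ) :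
    RTT η (u - v) (monoMat η ξ K u) (monoMat η ξ K v) :=
  (RTT_map_algebraMap η (u - v) K).mul (RTT_chainProd η ξ u v nodup_sites)
    (fun _ _ k l => (commute_map_algebraMap K _ k l).symm)
    (fun i j _ _ => commute_map_algebraMap K _ i j)

theorem one_add_swapMat_mul_monoMat {η : ℂ} (hη : η ≠ 0) (ξ : Fin N → ℂ)
    (K : Matrix (Fin 3) (Fin 3) ℂ) (b : Fin N) :
    (1 + swapMat) * (monoMat η ξ K (ξ b) ⊗ₖ monoMat η ξ K (ξ b - η)) = 0 := by
  rw [kronecker_monoMat, ← mul_assoc, (RTT_map_algebraMap η η K).one_add_swapMat_mul hη, mul_assoc,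
    one_add_swapMat_mul_chainProd hη ξ b nodup_sites (mem_sites b), mul_zero]

theorem T1_mul_T1 {η : ℂ} (hη : η ≠ 0) (ξ : Fin N → ℂ) (K : Matrix (Fin 3) (Fin 3) ℂ)
    (b : Fin N) : T1 η ξ K (ξ b) * T1 η ξ K (ξ b - η) = T2 η ξ K (ξ b) := by
  rw [T1_eq_trace, T1_eq_trace, T2_eq_fusedTrace,
    fusedTrace_eq_trace_mul_trace (one_add_swapMat_mul_monoMat hη ξ K b)]

theorem T2_add_eq_zero {η : ℂ} (hη : η ≠ 0) (ξ : Fin N → ℂ) (K : Matrix (Fin 3) (Fin 3) ℂ)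
    (b : Fin N) : T2 η ξ K (ξ b + η) = 0 := by
  rw [T2_eq_fusedTrace, add_sub_cancel_right]
  refine fusedTrace_eq_zero ?_
  rw [kronecker_monoMat, mul_assoc,
    chainProd_mul_one_sub_swapMat hη ξ b nodup_sites (mem_sites b), mul_zero]

theorem exists_T1_mul_T2_eq_smul_one {η : ℂ} (hη : η ≠ 0) (ξ : Fin N → ℂ)
    (K : Matrix (Fin 3) (Fin 3) ℂ) (b : Fin N) :
    ∃ q : ℂ, T1 η ξ K (ξ b) * T2 η ξ K (ξ b - η) = q • 1 := by
  obtain ⟨q, hq⟩ := exists_hasQDet_chainProd η ξ (ξ b) nodup_sites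
  have hq' := (hasQDet_map_algebraMap K).mul hq
    (fun _ _ k l => (commute_map_algebraMap K _ k l).symm)
    (fun _ _ k l => (commute_map_algebraMap K _ k l).symm)
    (fun _ _ k l => (commute_map_algebraMap K _ k l).symm)
  have hR := RTT_monoMat η ξ K (ξ b - η) (ξ b - 2 * η)
  rw [show ξ b - η - (ξ b - 2 * η) = η by ring] at hR
  refine ⟨K.det * q, ?_⟩
  rw [T1_eq_trace, T2_eq_fusedTrace, show ξ b - η - η = ξ b - 2 * η by ring]
  refine trace_mul_fusedTrace (one_add_swapMat_mul_monoMat hη ξ K b) ?_ hq'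
  rw [← mul_assoc, hR.one_add_swapMat_mul hη, mul_assoc, one_add_swapMat_mul_one_sub_swapMat,
    mul_zero]

theorem commute_T1_of_ne (η : ℂ) (ξ : Fin N → ℂ) (K : Matrix (Fin 3) (Fin 3) ℂ) {u v : ℂ}
    (h1 : u ≠ v + η) (h2 : u ≠ v - η) : Commute (T1 η ξ K u) (T1 η ξ K v) := by
  rw [T1_eq_trace, T1_eq_trace]
  refine (RTT_monoMat η ξ K u v).commute_trace fun h => ?_
  rcases sq_eq_sq_iff_eq_or_eq_neg.1 h with h | h
  · exact h1 (by linear_combination h)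
  · exact h2 (by linear_combination h)

end Chain

section Polynomiality

/-- `f` is a polynomial function of degree at most `d` whose coefficient of degree `d` is `c`. -/
def IsPolyFun (d : ℕ) (c : ℂ) (f : ℂ → ℂ) : Prop :=
  ∃ p : Polynomial ℂ, p.natDegree ≤ d ∧ p.coeff d = c ∧ ∀ x, f x = p.eval x

theorem IsPolyFun.const (c : ℂ) : IsPolyFun 0 c fun _ => c :=
  ⟨Polynomial.C c, by simp, by simp, by simp⟩

theorem IsPolyFun.mul {d d' : ℕ} {c c' : ℂ} {f g : ℂ → ℂ} (hf : IsPolyFun d c f)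
    (hg : IsPolyFun d' c' g) : IsPolyFun (d + d') (c * c') fun x => f x * g x := by
  obtain ⟨p, hp, hpc, hpe⟩ := hf
  obtain ⟨q, hq, hqc, hqe⟩ := hg
  refine ⟨p * q, Polynomial.natDegree_mul_le_of_le hp hq, ?_, fun x => ?_⟩
  · rw [Polynomial.coeff_mul_add_eq_of_natDegree_le hp hq, hpc, hqc]
  · simp only [Polynomial.eval_mul, hpe, hqe]

theorem IsPolyFun.mul_const {d : ℕ} {c : ℂ} {f : ℂ → ℂ} (hf : IsPolyFun d c f) (a : ℂ) :
    IsPolyFun d (c * a) fun x => f x * a :=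
  hf.mul (IsPolyFun.const a)

theorem IsPolyFun.sum {ι : Type*} {s : Finset ι} {d : ℕ} {c : ι → ℂ} {f : ι → ℂ → ℂ}
    (hf : ∀ i ∈ s, IsPolyFun d (c i) (f i)) :
    IsPolyFun d (∑ i ∈ s, c i) fun x => ∑ i ∈ s, f i x := by
  choose! p hp hpc hpe using hf
  refine ⟨∑ i ∈ s, p i, Polynomial.natDegree_sum_le_of_forall_le s p hp, ?_, fun x => ?_⟩
  · rw [Polynomial.finsetSum_coeff]
    exact Finset.sum_congr rfl hpc
  · rw [Polynomial.eval_finsetSum]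
    exact Finset.sum_congr rfl fun i hi => hpe i hi x

theorem IsPolyFun.affine (a b s : ℂ) : IsPolyFun 1 a fun x => (x - s) * a + b := by
  refine ⟨Polynomial.C a * Polynomial.X + Polynomial.C (b - s * a),
    Polynomial.natDegree_linear_le, by simp, fun x => ?_⟩
  simp only [Polynomial.eval_add, Polynomial.eval_mul, Polynomial.eval_C, Polynomial.eval_X]
  ring

theorem IsPolyFun.eq_zero {ι : Type*} [Fintype ι] {d : ℕ} {f : ℂ → ℂ}
    (hf : IsPolyFun d 0 f) (hd : d = Fintype.card ι) {x : ι → ℂ} (hx : Function.Injective x)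
    (h0 : ∀ i, f (x i) = 0) (z : ℂ) : f z = 0 := by
  obtain ⟨p, hp, hpc, hpe⟩ := hf
  suffices p = 0 by rw [hpe, this, Polynomial.eval_zero]
  by_contra hne
  refine hne (Polynomial.eq_zero_of_natDegree_lt_card_of_eval_eq_zero p hx
    (fun i => (hpe _).symm.trans (h0 i)) (hd ▸ lt_of_le_of_ne hp fun h => hne ?_))
  rwa [← h, Polynomial.coeff_natDegree, Polynomial.leadingCoeff_eq_zero] at hpc

/-- The entries of `F` are polynomial functions of degree at most `d` with coefficients of
degree `d` given by `C`. -/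
def IsPolyMat {I J : Type*} (d : ℕ) (C : Matrix I J ℂ) (F : ℂ → Matrix I J ℂ) : Prop :=
  ∀ i j, IsPolyFun d (C i j) fun x => F x i j

theorem IsPolyMat.const {I J : Type*} (C : Matrix I J ℂ) : IsPolyMat 0 C fun _ => C :=
  fun _ _ => IsPolyFun.const _

theorem IsPolyMat.mul {I J L : Type*} [Fintype J] {d d' : ℕ} {C : Matrix I J ℂ}
    {C' : Matrix J L ℂ} {F : ℂ → Matrix I J ℂ} {G : ℂ → Matrix J L ℂ} (hF : IsPolyMat d C F)
    (hG : IsPolyMat d' C' G) : IsPolyMat (d + d') (C * C') fun x => F x * G x :=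
  fun i j => IsPolyFun.sum fun e _ => (hF i e).mul (hG e j)

theorem IsPolyMat.listProd {I ι : Type*} [Fintype I] [DecidableEq I] {F : ℂ → ι → Matrix I I ℂ}
    (hF : ∀ n, IsPolyMat 1 1 fun x => F x n) (l : List ι) :
    IsPolyMat l.length 1 fun x => (l.map (F x)).prod := by
  induction l with
  | nil => simpa using IsPolyMat.const (1 : Matrix I I ℂ)
  | cons n l ih =>
    have := (hF n).mul ih
    rw [mul_one, add_comm] at this
    simpa using this

theorem IsPolyMat.apply {I J : Type*} [Fintype I] [Fintype J] [DecidableEq I] [DecidableEq J]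
    {d : ℕ} {C : Matrix I J ℂ} {F : ℂ → Matrix I J ℂ} (hF : IsPolyMat d C F)
    (φ : Matrix I J ℂ →ₗ[ℂ] ℂ) : IsPolyFun d (φ C) fun x => φ (F x) := by
  have h (A : Matrix I J ℂ) : φ A = ∑ i, ∑ j, A i j * φ (Matrix.single i j 1) := by
    conv_lhs => rw [Matrix.matrix_eq_sum_single A]
    simp only [map_sum]
    refine Finset.sum_congr rfl fun i _ => Finset.sum_congr rfl fun j _ => ?_
    rw [← smul_eq_mul, ← map_smul, Matrix.smul_single, smul_eq_mul, mul_one]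
  rw [h C, funext fun x => h (F x)]
  exact IsPolyFun.sum fun i _ => IsPolyFun.sum fun j _ => (hF i j).mul_const _

theorem IsPolyMat.mem {I J ι : Type*} [Fintype I] [Fintype J] [DecidableEq I] [DecidableEq J]
    [Fintype ι] {d : ℕ} {C : Matrix I J ℂ} {F : ℂ → Matrix I J ℂ}
    (hF : IsPolyMat d C F) (hd : d = Fintype.card ι) {S : Submodule ℂ (Matrix I J ℂ)} (hC : C ∈ S)
    {x : ι → ℂ} (hx : Function.Injective x) (h : ∀ i, F (x i) ∈ S) (z : ℂ) : F z ∈ S := by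
  by_contra hz
  obtain ⟨φ, hφ, hS⟩ := Submodule.exists_dual_map_eq_bot_of_notMem hz inferInstance
  have h0 (A : Matrix I J ℂ) (hA : A ∈ S) : φ A = 0 := by
    have := Submodule.mem_map_of_mem (f := φ) hA
    rwa [hS, Submodule.mem_bot] at this
  have := hF.apply φ
  rw [h0 C hC] at this
  exact hφ (this.eq_zero hd hx (fun i => h0 _ (h i)) z)

variable {N : ℕ} (η : ℂ) (ξ : Fin N → ℂ) (K : Matrix (Fin 3) (Fin 3) ℂ)

theorem isPolyMat_monodromy (s : ℂ) :
    IsPolyMat N (Kaux K) fun x => monodromy η ξ K (x - s) := by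
  have hR (n : Fin N) : IsPolyMat 1 1 fun x => Raux η ξ (x - s) n := by
    intro p q
    have := IsPolyFun.affine ((1 : Matrix (Fin 3 × St N) (Fin 3 × St N) ℂ) p q)
      (η * (if p.1 = q.2 n ∧ p.2 = Function.update q.2 n q.1 then 1 else 0)) (s + ξ n)
    simpa only [Raux, Matrix.of_apply, Matrix.one_apply, ← sub_sub] using this
  have := (IsPolyMat.const (Kaux (N := N) K)).mul (IsPolyMat.listProd hR (List.finRange N).reverse)
  rw [mul_one, zero_add, List.length_reverse, List.length_finRange] at this
  simpa only [monodromy, List.ofFn_eq_map, List.map_reverse] using this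

theorem isPolyMat_T1 : IsPolyMat N (K.trace • 1) (T1 η ξ K) := by
  intro f g
  have h := isPolyMat_monodromy η ξ K 0
  simp only [sub_zero] at h
  have := IsPolyFun.sum (s := Finset.univ) fun (v : Fin 3) _ => h (v, f) (v, g)
  suffices hc : (K.trace • (1 : Op N)) f g = ∑ v : Fin 3, Kaux K (v, f) (v, g) by
    rw [hc]
    exact this
  by_cases hfg : f = g <;> simp [Kaux, Matrix.trace, hfg]

theorem exists_isPolyMat_T2 : ∃ c : ℂ, IsPolyMat (N + N) (c • 1) (T2 η ξ K) := by
  refine ⟨∑ v : Fin 3 × Fin 3, 2⁻¹ * (K v.1 v.1 * K v.2 v.2 - K v.2 v.1 * K v.1 v.2),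
    fun f g => ?_⟩
  have h0 := isPolyMat_monodromy η ξ K 0
  simp only [sub_zero] at h0
  have h1 : IsPolyMat N (emb1 (Kaux K)) fun x => emb1 (monodromy η ξ K x) :=
    fun p q => (h0 _ _).mul_const _
  have h2 : IsPolyMat N (emb2 (Kaux K)) fun x => emb2 (monodromy η ξ K (x - η)) :=
    fun p q => (isPolyMat_monodromy η ξ K η _ _).mul_const _
  have h := ((IsPolyMat.const (antisym2 (N := N))).mul h1).mul h2
  rw [zero_add] at h
  have := IsPolyFun.sum (s := Finset.univ) fun (v : Fin 3 × Fin 3) _ => h (v, f) (v, g)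
  suffices hc : (∑ v : Fin 3 × Fin 3, 2⁻¹ * (K v.1 v.1 * K v.2 v.2 - K v.2 v.1 * K v.1 v.2)) •
      (1 : Op N) f g = ∑ v : Fin 3 × Fin 3,
        (antisym2 * emb1 (Kaux K) * emb2 (Kaux K) :
          Matrix ((Fin 3 × Fin 3) × St N) ((Fin 3 × Fin 3) × St N) ℂ) (v, f) (v, g) by
    rw [Matrix.smul_apply, hc]
    exact this
  rw [Matrix.one_apply, smul_eq_mul, Finset.sum_mul]
  refine Finset.sum_congr rfl fun v _ => ?_
  rw [Matrix.mul_assoc, antisym2_mul_apply, Prod.swap, emb1_mul_emb2_apply, emb1_mul_emb2_apply]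
  by_cases hfg : f = g <;> simp [Kaux, hfg]

variable {η ξ}

theorem T1_mem {S : Submodule ℂ (Op N)} (h1 : 1 ∈ S) {x : Fin N → ℂ}
    (hx : Function.Injective x) (h : ∀ b, T1 η ξ K (x b) ∈ S) (lam : ℂ) : T1 η ξ K lam ∈ S :=
  (isPolyMat_T1 η ξ K).mem (Fintype.card_fin N).symm (S.smul_mem _ h1) hx h lam

theorem InhomCond.injective_add (hξ : InhomCond η ξ) (a : ℂ) :
    Function.Injective fun b => ξ b + a := by
  intro b c hbc
  by_contra hne
  exact (hξ b c hne).1 (by linear_combination hbc)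

theorem T2_mem (hη : η ≠ 0) (hξ : InhomCond η ξ) {S : Submodule ℂ (Op N)} (h1 : 1 ∈ S)
    {x : Fin N → ℂ} (hx : Function.Injective x) (hxξ : ∀ b c, x b ≠ ξ c + η)
    (h : ∀ b, T2 η ξ K (x b) ∈ S) (lam : ℂ) : T2 η ξ K lam ∈ S := by
  obtain ⟨c, hT⟩ := exists_isPolyMat_T2 η ξ K
  refine hT.mem (by simp) (S.smul_mem _ h1) (x := Sum.elim x fun b => ξ b + η)
    (hx.sumElim (hξ.injective_add η) hxξ) ?_ lam
  rintro (b | b)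
  · exact h b
  · rw [Sum.elim_inr, T2_add_eq_zero hη]
    exact S.zero_mem

theorem commute_iff_mem_centralizer (X Y : Op N) :
    Commute X Y ↔ Y ∈ Subalgebra.toSubmodule (Subalgebra.centralizer ℂ {X}) := by
  simp [Subalgebra.mem_centralizer_iff, Commute, SemiconjBy]

theorem one_mem_centralizer (X : Op N) :
    1 ∈ Subalgebra.toSubmodule (Subalgebra.centralizer ℂ {X}) :=
  (commute_iff_mem_centralizer X 1).1 (Commute.one_right X)

theorem commute_T1 (hη : η ≠ 0) (u v : ℂ) : Commute (T1 η ξ K u) (T1 η ξ K v) := by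
  rw [commute_iff_mem_centralizer]
  refine T1_mem K (one_mem_centralizer _) (x := fun i => u + η * (i + 2)) ?_ (fun i => ?_) v
  · intro i j hij
    simpa [hη, Fin.ext_iff] using hij
  · rw [← commute_iff_mem_centralizer]
    refine commute_T1_of_ne η ξ K (fun h => ?_) fun h => ?_
    · have : η * ((i + 3 : ℕ) : ℂ) = 0 := by push_cast; linear_combination -h
      exact mul_ne_zero hη (Nat.cast_ne_zero.2 (Nat.succ_ne_zero _)) this
    · have : η * ((i + 1 : ℕ) : ℂ) = 0 := by push_cast; linear_combination -h
      exact mul_ne_zero hη (Nat.cast_ne_zero.2 (Nat.succ_ne_zero _)) this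

theorem commute_T2_of_commute_T1 (hη : η ≠ 0) (hξ : InhomCond η ξ) {X : Op N}
    (hX : ∀ u, Commute X (T1 η ξ K u)) (v : ℂ) : Commute X (T2 η ξ K v) := by
  rw [commute_iff_mem_centralizer]
  refine T2_mem K hη hξ (one_mem_centralizer _) (x := ξ) ?_ (fun b c h => ?_) (fun b => ?_) v
  · simpa using hξ.injective_add 0
  · by_cases hbc : b = c
    · subst hbc
      exact hη (by linear_combination -h)
    · exact (hξ b c hbc).2.1 (by linear_combination h)
  · rw [← commute_iff_mem_centralizer, ← T1_mul_T1 hη]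
    exact (hX _).mul_right (hX _)

theorem commute_T1_T2 (hη : η ≠ 0) (hξ : InhomCond η ξ) (u v : ℂ) :
    Commute (T1 η ξ K u) (T2 η ξ K v) :=
  commute_T2_of_commute_T1 K hη hξ (commute_T1 K hη u) v

theorem commute_T2 (hη : η ≠ 0) (hξ : InhomCond η ξ) (u v : ℂ) :
    Commute (T2 η ξ K u) (T2 η ξ K v) :=
  commute_T2_of_commute_T1 K hη hξ (fun w => (commute_T1_T2 K hη hξ w u).symm) v

end Polynomiality

section SeparatedStates

theorem prod_ofFn_mul {M : Type*} [Monoid M] {n : ℕ} {f g : Fin n → M} {x : M} (b : Fin n)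
    (hx : ∀ i, Commute (f i) x) (hb : f b * x = g b) (h : ∀ i, i ≠ b → f i = g i) :
    (List.ofFn f).prod * x = (List.ofFn g).prod := by
  induction n with
  | zero => exact b.elim0
  | succ n ih =>
    rw [List.ofFn_succ, List.ofFn_succ, List.prod_cons, List.prod_cons]
    induction b using Fin.cases with
    | zero =>
      have hc : Commute (List.ofFn fun i : Fin n => f i.succ).prod x := by
        refine Commute.list_prod_left _ _ fun y hy => ?_
        obtain ⟨i, rfl⟩ := List.mem_ofFn.1 hy
        exact hx _
      rw [mul_assoc, hc.eq, ← mul_assoc, hb, funext fun i : Fin n => h i.succ (Fin.succ_ne_zero i)]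
    | succ b =>
      rw [mul_assoc, h 0 (Fin.succ_ne_zero b).symm,
        ih b (fun i => hx _) hb fun i hi => h _ fun h' => hi (Fin.succ_injective _ h')]

variable {N : ℕ} {η : ℂ} {ξ : Fin N → ℂ} (K : Matrix (Fin 3) (Fin 3) ℂ) {h k : St N}

theorem sovCovOp_mul_T1_of_eq_one (hη : η ≠ 0) (hξ : InhomCond η ξ) {b : Fin N} (hb : h b = 1) :
    sovCovOp η ξ K h * T1 η ξ K (ξ b) = sovCovOp η ξ K (Function.update h b 2) := by
  refine prod_ofFn_mul b (fun i => ?_) (by simp [hb]) fun i hi => by simp [hi]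
  exact ((commute_T1_T2 K hη hξ _ _).symm.pow_left _).mul_left ((commute_T1 K hη _ _).pow_left _)

theorem sovCovOp_mul_T2_of_eq_one (hη : η ≠ 0) (hξ : InhomCond η ξ) {b : Fin N} (hb : h b = 1) :
    sovCovOp η ξ K h * T2 η ξ K (ξ b - η) = sovCovOp η ξ K (Function.update h b 0) := by
  refine prod_ofFn_mul b (fun i => ?_) (by simp [hb]) fun i hi => by simp [hi]
  exact ((commute_T2 K hη hξ _ _).pow_left _).mul_left ((commute_T1_T2 K hη hξ _ _).pow_left _)

theorem sovVecOp_mul_T1 (hη : η ≠ 0) (hξ : InhomCond η ξ) {a : Fin N} (ha : k a = 0) :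
    sovVecOp η ξ K k * T1 η ξ K (ξ a) = sovVecOp η ξ K (Function.update k a 2) := by
  refine prod_ofFn_mul a (fun i => ?_) (by simp [ha]) fun i hi => by simp [hi]
  exact ((commute_T1_T2 K hη hξ _ _).symm.pow_left _).mul_left ((commute_T1 K hη _ _).pow_left _)

theorem commute_sovVecOp_T1 (hη : η ≠ 0) (hξ : InhomCond η ξ) (k : St N) (u : ℂ) :
    Commute (sovVecOp η ξ K k) (T1 η ξ K u) := by
  refine Commute.list_prod_left _ _ fun y hy => ?_
  obtain ⟨i, rfl⟩ := List.mem_ofFn.1 hy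
  exact ((commute_T1_T2 K hη hξ _ _).symm.pow_left _).mul_left ((commute_T1 K hη _ _).pow_left _)

theorem sovVecOp_zeroSt : sovVecOp η ξ K zeroSt = 1 := by
  simp [sovVecOp, zeroSt]

theorem sovCovOp_eq_of_eq_two (hη : η ≠ 0) (hξ : InhomCond η ξ) {b : Fin N} (hb : h b = 2) :
    sovCovOp η ξ K h = sovCovOp η ξ K (Function.update h b 1) * T1 η ξ K (ξ b) := by
  rw [sovCovOp_mul_T1_of_eq_one K hη hξ (Function.update_self b 1 h), Function.update_idem, ← hb,
    Function.update_eq_self]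

theorem sovCovOp_eq_of_eq_zero (hη : η ≠ 0) (hξ : InhomCond η ξ) {b : Fin N} (hb : h b = 0) :
    sovCovOp η ξ K h = sovCovOp η ξ K (Function.update h b 1) * T2 η ξ K (ξ b - η) := by
  rw [sovCovOp_mul_T2_of_eq_one K hη hξ (Function.update_self b 1 h), Function.update_idem, ← hb,
    Function.update_eq_self]

theorem sub_ne_two_mul (hη : η ≠ 0) (hξ : InhomCond η ξ) {L : Hsp N}
    (hbL : IsBasisFamily (sovCov η ξ K L)) (b c : Fin N) : ξ b - ξ c ≠ 2 * η := by
  intro hbc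
  refine hbL.1.ne_zero zeroSt ?_
  rw [sovCov, sovCovOp_eq_of_eq_zero K hη hξ (h := zeroSt) (b := b) rfl,
    show ξ b - η = ξ c + η by linear_combination hbc, T2_add_eq_zero hη, mul_zero,
    Matrix.vecMul_zero]

/-- The labels `h` for which `⟨h| T₁(λ) |k⟩` may be nonzero. -/
def IsT1Neighbour (k h : St N) : Prop :=
  h = k ∨ ∃ b, (k b = 2 ∧ h = Function.update k b 1) ∨ (k b = 0 ∧ h = Function.update k b 2)

/-- The labels `h` for which `⟨h| T₂(λ) |k⟩` may be nonzero. -/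
def IsT2Neighbour (k h : St N) : Prop :=
  h = k ∨ ∃ b, (k b = 0 ∧ h = Function.update k b 1) ∨ (k b = 2 ∧ h = Function.update k b 0)

theorem update_one_ne (hk : ∀ a, k a ≠ 1) (b : Fin N) : Function.update h b 1 ≠ k := by
  rintro rfl
  exact hk b (Function.update_self b 1 h)

theorem eq_update_of_update_eq {b : Fin N} {v w : Fin 3} (hb : h b = v)
    (hu : Function.update h b w = Function.update k b w) : h = Function.update k b v := by
  have := congrArg (fun f => Function.update f b v) hu
  simpa [← hb] using this

theorem not_isT2Neighbour_update (hk : ∀ a, k a ≠ 1) (hh : ¬ IsT1Neighbour k h) {b : Fin N}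
    (hb : h b = 2) : ¬ IsT2Neighbour k (Function.update h b 1) := by
  rintro (hu | ⟨c, ⟨hc, hu⟩ | ⟨hc, hu⟩⟩)
  · exact update_one_ne hk b hu
  · have hbc : b = c := by
      by_contra hne
      have := congrFun hu b
      rw [Function.update_self, Function.update_of_ne hne] at this
      exact hk b this.symm
    subst hbc
    exact hh (Or.inr ⟨b, Or.inr ⟨hc, eq_update_of_update_eq hb hu⟩⟩)
  · refine update_one_ne (k := Function.update k c 0) (fun a => ?_) b hu
    by_cases hac : a = c
    · simp [hac]
    · simp [hac, hk a]

theorem not_isT1Neighbour_update (hk : ∀ a, k a ≠ 1) (hh : ¬ IsT2Neighbour k h) {b : Fin N}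
    (hb : h b = 0) : ¬ IsT1Neighbour k (Function.update h b 1) := by
  rintro (hu | ⟨c, ⟨hc, hu⟩ | ⟨hc, hu⟩⟩)
  · exact update_one_ne hk b hu
  · have hbc : b = c := by
      by_contra hne
      have := congrFun hu b
      rw [Function.update_self, Function.update_of_ne hne] at this
      exact hk b this.symm
    subst hbc
    exact hh (Or.inr ⟨b, Or.inr ⟨hc, eq_update_of_update_eq hb hu⟩⟩)
  · refine update_one_ne (k := Function.update k c 2) (fun a => ?_) b hu
    by_cases hac : a = c
    · simp [hac]
    · simp [hac, hk a]

theorem card_ne_one_update_lt {b : Fin N} (hb : h b ≠ 1) :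
    (Finset.univ.filter fun a => Function.update h b 1 a ≠ 1).card <
      (Finset.univ.filter fun a => h a ≠ 1).card := by
  refine Finset.card_lt_card ((Finset.ssubset_iff_of_subset fun a ha => ?_).2 ⟨b, ?_, ?_⟩)
  · rw [Finset.mem_filter] at ha ⊢
    refine ⟨ha.1, fun h' => ha.2 ?_⟩
    by_cases hab : a = b
    · rw [hab, Function.update_self]
    · rw [Function.update_of_ne hab, h']
  · simpa using hb
  · simp

theorem InhomCond.injective_ite (hξ : InhomCond η ξ) (p : Fin N → Prop)
    [DecidablePred p] : Function.Injective fun b => if p b then ξ b - η else ξ b := by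
  intro b c hbc
  by_contra hne
  obtain ⟨h0, h1, h2⟩ := hξ b c hne
  dsimp only at hbc
  split_ifs at hbc
  · exact h0 (by linear_combination hbc)
  · exact h1 (by linear_combination hbc)
  · exact h2 (by linear_combination hbc)
  · exact h0 (by linear_combination hbc)

variable {K}

theorem map_sovCovOp_mul_eq_zero (hη : η ≠ 0) (hξ : InhomCond η ξ)
    (hξ2 : ∀ b c, ξ b - ξ c ≠ 2 * η) (hk : ∀ a, k a ≠ 1) {φ : Op N →ₗ[ℂ] ℂ}
    (hφ : ∀ h, h ≠ k → φ (sovCovOp η ξ K h) = 0) (h : St N) :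
    (¬ IsT1Neighbour k h → ∀ lam, φ (sovCovOp η ξ K h * T1 η ξ K lam) = 0) ∧
      (¬ IsT2Neighbour k h → ∀ lam, φ (sovCovOp η ξ K h * T2 η ξ K lam) = 0) := by
  induction hm : (Finset.univ.filter fun a => h a ≠ 1).card using Nat.strong_induction_on
    generalizing h with
  | _ m ih =>
  subst hm
  let S : Submodule ℂ (Op N) := LinearMap.ker (φ ∘ₗ LinearMap.mulLeft ℂ (sovCovOp η ξ K h))
  have hS (Z : Op N) : Z ∈ S ↔ φ (sovCovOp η ξ K h * Z) = 0 := Iff.rfl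
  have hpush {b : Fin N} {v : Fin 3} (hb : h b = 1) (hu : Function.update h b v = k) :
      k b = v ∧ h = Function.update k b 1 := by
    subst hu
    simp [← hb]
  have hq (b : Fin N) := exists_T1_mul_T2_eq_smul_one hη ξ K b
  have h3 (x : Fin 3) : x = 0 ∨ x = 1 ∨ x = 2 := by fin_cases x <;> simp
  constructor
  · intro hh
    refine T1_mem K (S := S) ?_ (hξ.injective_ite fun b => h b = 2) fun b => ?_
    · rw [hS, mul_one]
      exact hφ h fun e => hh (Or.inl e)
    · rw [hS]
      rcases h3 (h b) with hb | hb | hb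
      · obtain ⟨q, hq⟩ := hq b
        rw [if_neg (by simp [hb]), sovCovOp_eq_of_eq_zero K hη hξ hb, mul_assoc,
          ← (commute_T1_T2 K hη hξ _ _).eq, hq, mul_smul_comm, mul_one, map_smul,
          hφ _ (update_one_ne hk b), smul_zero]
      · rw [if_neg (by simp [hb]), sovCovOp_mul_T1_of_eq_one K hη hξ hb]
        exact hφ _ fun e => hh (Or.inr ⟨b, Or.inl (hpush hb e)⟩)
      · rw [if_pos hb, sovCovOp_eq_of_eq_two K hη hξ hb, mul_assoc, T1_mul_T1 hη]
        exact (ih _ (card_ne_one_update_lt (by simp [hb])) _ rfl).2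
          (not_isT2Neighbour_update hk hh hb) _
  · intro hh
    refine T2_mem K hη hξ (S := S) ?_ (hξ.injective_ite fun b => h b ≠ 0) (fun b c e => ?_)
      fun b => ?_
    · rw [hS, mul_one]
      exact hφ h fun e => hh (Or.inl e)
    · split_ifs at e
      · exact hξ2 b c (by linear_combination e)
      · by_cases hbc : b = c
        · subst hbc
          exact hη (by linear_combination -e)
        · exact (hξ b c hbc).2.1 (by linear_combination e)
    · rw [hS]
      rcases h3 (h b) with hb | hb | hb
      · obtain ⟨q, hq⟩ := hq b
        rw [if_neg (by simp [hb]), sovCovOp_eq_of_eq_zero K hη hξ hb, mul_assoc, ← T1_mul_T1 hη,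
          ← mul_assoc (T2 η ξ K _), ← (commute_T1_T2 K hη hξ _ _).eq, hq, smul_one_mul,
          mul_smul_comm, map_smul, (ih _ (card_ne_one_update_lt (by simp [hb])) _ rfl).1
            (not_isT1Neighbour_update hk hh hb), smul_zero]
      · rw [if_pos (by simp [hb]), sovCovOp_mul_T2_of_eq_one K hη hξ hb]
        exact hφ _ fun e => hh (Or.inr ⟨b, Or.inl (hpush hb e)⟩)
      · obtain ⟨q, hq⟩ := hq b
        rw [if_pos (by simp [hb]), sovCovOp_eq_of_eq_two K hη hξ hb, mul_assoc, hq, mul_smul_comm,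
          mul_one, map_smul, hφ _ (update_one_ne hk b), smul_zero]

variable (η ξ K)

/-- The matrix element `⟨L| Z Y_k |R⟩` as a linear functional of `Z`, where `Y_k` generates the
SoV vector of label `k`. -/
def matrixElement (L R0 : Hsp N) (k : St N) : Op N →ₗ[ℂ] ℂ where
  toFun Z := L ⬝ᵥ (Z * sovVecOp η ξ K k) *ᵥ R0
  map_add' Z W := by rw [add_mul, Matrix.add_mulVec, dotProduct_add]
  map_smul' c Z := by
    rw [smul_mul_assoc, Matrix.smul_mulVec, dotProduct_smul, RingHom.id_apply]

variable {η ξ K}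

theorem pair_vecMul_sovVec (L R0 : Hsp N) (h k : St N) (Z : Op N) :
    pair (Matrix.vecMul (sovCov η ξ K L h) Z) (sovVec η ξ K R0 k) =
      matrixElement η ξ K L R0 k (sovCovOp η ξ K h * Z) := by
  change (L ᵥ* sovCovOp η ξ K h) ᵥ* Z ⬝ᵥ sovVecOp η ξ K k *ᵥ R0 = _
  rw [Matrix.vecMul_vecMul, ← Matrix.dotProduct_mulVec, Matrix.mulVec_mulVec]
  rfl

theorem matrixElement_update (hη : η ≠ 0) (hξ : InhomCond η ξ) (L R0 : Hsp N) {a : Fin N}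
    (ha : k a = 0) (Z : Op N) : matrixElement η ξ K L R0 (Function.update k a 2) Z =
      matrixElement η ξ K L R0 k (Z * T1 η ξ K (ξ a)) := by
  change L ⬝ᵥ (_ * _) *ᵥ R0 = L ⬝ᵥ (_ * _) *ᵥ R0
  rw [← sovVecOp_mul_T1 K hη hξ ha, (commute_sovVecOp_T1 K hη hξ _ _).eq, mul_assoc]

theorem matrixElement_sovCovOp_eq_zero (hη : η ≠ 0) (hξ : InhomCond η ξ)
    (hξ2 : ∀ b c, ξ b - ξ c ≠ 2 * η) {L R0 : Hsp N} (hR0 : DualRef η ξ K L R0)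
    (hk : ∀ a, k a ≠ 1) (hh : h ≠ k) : matrixElement η ξ K L R0 k (sovCovOp η ξ K h) = 0 := by
  induction hm : (Finset.univ.filter fun a => k a = 2).card generalizing h k with
  | zero =>
    have hk0 : k = zeroSt := by
      ext1 a
      have h2 : k a ≠ 2 := by
        rw [Finset.card_eq_zero, Finset.filter_eq_empty_iff] at hm
        exact hm (Finset.mem_univ a)
      have h1 := hk a
      simp only [zeroSt]
      lia
    have := hR0 h
    rw [if_neg (hk0 ▸ hh)] at this
    rw [← this, hk0]
    change L ⬝ᵥ (_ * _) *ᵥ R0 = (L ᵥ* _) ⬝ᵥ R0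
    rw [sovVecOp_zeroSt, mul_one, Matrix.dotProduct_mulVec]
  | succ m ih =>
    obtain ⟨a, ha⟩ : (Finset.univ.filter fun a => k a = 2).Nonempty := by
      rw [← Finset.card_pos]
      lia
    have ha2 : k a = 2 := (Finset.mem_filter.1 ha).2
    set k' := Function.update k a 0 with hk'
    have hka : k' a = 0 := Function.update_self a 0 k
    have hkk : k = Function.update k' a 2 := by simp [hk', ← ha2]
    have hk1 (c : Fin N) : k' c ≠ 1 := by
      by_cases hc : c = a
      · simp [hk', hc]
      · simp [hk', hc, hk c]
    have hcard : (Finset.univ.filter fun c => k' c = 2).card = m := by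
      have : (Finset.univ.filter fun c => k' c = 2) =
          (Finset.univ.filter fun c => k c = 2).erase a := by
        ext c
        by_cases hc : c = a <;> simp [hk', hc]
      rw [this, Finset.card_erase_of_mem ha, hm, Nat.add_sub_cancel]
    have hφ (g : St N) (hg : g ≠ k') : matrixElement η ξ K L R0 k' (sovCovOp η ξ K g) = 0 :=
      ih hk1 hg hcard
    rw [hkk] at hh ⊢
    rw [matrixElement_update hη hξ L R0 hka]
    by_cases hn : IsT1Neighbour k' h
    · have h0 : h a = 0 := by
        rcases hn with rfl | ⟨b, ⟨hb, rfl⟩ | ⟨hb, rfl⟩⟩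
        · exact hka
        · rw [Function.update_of_ne (fun e => by simp [← e, hka] at hb), hka]
        · rw [Function.update_of_ne (fun e => hh (by rw [e])), hka]
      obtain ⟨q, hq⟩ := exists_T1_mul_T2_eq_smul_one hη ξ K a
      rw [sovCovOp_eq_of_eq_zero K hη hξ h0, mul_assoc, ← (commute_T1_T2 K hη hξ _ _).eq, hq,
        mul_smul_comm, mul_one, map_smul, hφ _ (update_one_ne hk1 a), smul_zero]
    · exact (map_sovCovOp_mul_eq_zero hη hξ hξ2 hk1 hφ h).1 hn _

theorem not_isT1Neighbour
    (hh : (∃ a b : Fin N, a ≠ b ∧ h a ≠ k a ∧ h b ≠ k b) ∨ (∃ a, h a = 1 ∧ k a = 0))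
    (hk : ∀ a, k a ≠ 1) : ¬ IsT1Neighbour k h := by
  have hdiff {c : Fin N} {v : Fin 3} {a : Fin N} (ha : Function.update k c v a ≠ k a) : a = c := by
    by_contra hne
    exact ha (Function.update_of_ne hne v k)
  rintro (rfl | ⟨c, ⟨hc, rfl⟩ | ⟨hc, rfl⟩⟩)
  · rcases hh with ⟨a, -, -, ha, -⟩ | ⟨a, ha, ha'⟩
    · exact ha rfl
    · exact hk a ha
  · rcases hh with ⟨a, b, hab, ha, hb⟩ | ⟨a, ha, ha'⟩
    · exact hab ((hdiff ha).trans (hdiff hb).symm)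
    · have hac : a = c := hdiff (v := 1) (by rw [ha, ha']; decide)
      rw [hac, hc] at ha'
      exact absurd ha' (by decide)
  · rcases hh with ⟨a, b, hab, ha, hb⟩ | ⟨a, ha, ha'⟩
    · exact hab ((hdiff ha).trans (hdiff hb).symm)
    · refine update_one_ne (h := Function.update k c 2) (k := Function.update k c 2)
        (fun d => ?_) a (by rw [← ha, Function.update_eq_self])
      by_cases hd : d = c
      · simp [hd]
      · simp [hd, hk d]

end SeparatedStates

end
end SoV

namespace SoV
noncomputable section

/-- orthogonality lemma.  For `k ∈ {0,2}^N` and `h` differing from `k` in at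
least two places, or having some `h_a = 1` against `k_a = 0`, the matrix elements
`⟨h| T₁^{(K)}(ξ_c − (δ_{h_c,0}+δ_{h_c,1})η) |k⟩` all vanish. -/
theorem statement_15 (N : ℕ) (η : ℂ) (hη : η ≠ 0) (ξ : Fin N → ℂ) (hξ : InhomCond η ξ)
    (K : Matrix (Fin 3) (Fin 3) ℂ) (hK : SimpleSpectrum K) (L R0 : Hsp N)
    (hbL : IsBasisFamily (sovCov η ξ K L))
    (hR0 : DualRef η ξ K L R0)
    (hbR : IsBasisFamily (sovVec η ξ K R0))
    (k : St N) (hk : ∀ a, k a ≠ 1)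
    (h : St N)
    (hh : (∃ a b : Fin N, a ≠ b ∧ h a ≠ k a ∧ h b ≠ k b) ∨ (∃ a, h a = 1 ∧ k a = 0)) :
    ∀ c : Fin N,
      pair
        (Matrix.vecMul (sovCov η ξ K L h)
          (T1 η ξ K (ξ c -
            ((if h c = 0 then 1 else 0 : ℂ) + (if h c = 1 then 1 else 0)) * η)))
        (sovVec η ξ K R0 k) = 0 := by
  intro c
  rw [pair_vecMul_sovVec]
  have hξ2 := sub_ne_two_mul K hη hξ hbL
  exact (map_sovCovOp_mul_eq_zero hη hξ hξ2 hk
    (fun _ hg => matrixElement_sovCovOp_eq_zero hη hξ hξ2 hR0 hk hg) h).1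
    (not_isT1Neighbour hh hk) _

end
end SoV
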